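/- arXiv:1604.05269 — 2 statements merged into one kernel-verified Lean document; each statement's English description precedes it below -/
import Mathlib

section
/- Let p be an odd prime, Fp = ZMod p, let n ≥ 2, let k be even with 1 ≤ k ≤ n−1, and take s = 1. Then the number of distinct sets of the form { Q_P·M·Q_P⁻¹ : M ∈ T(n,k,1) }, as P ranges over GL_n(Fp) and Q_P = [[P,0],[0,1]] ∈ GL_{n+1}(Fp), equals |GL_n(Fp)| divided by (p−1) · |{ U a k×k matrix over Fp : Uᵀ·U = I }| · |GL_{n−1−k}(Fp)| · p^{k(n−1−k) + (n−1)}. -/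
open Matrix

/-- `d_i` (0-indexed): `d i = 1` for `i + 1 < k`, `d i = s` for `i + 1 = k`,
and `d i = 0` otherwise. -/
def dvec (p k : ℕ) (s : ZMod p) (i : ℕ) : ZMod p :=
  if i + 1 < k then 1 else if i + 1 = k then s else 0

/-- The `(n+1)×(n+1)` matrix `τ(r)`: it agrees with the identity except that its
`(i, n+1)` entry is `r_i` for `1 ≤ i ≤ n` and its `(n, j)` entry is `d_j·r_j`
for `1 ≤ j ≤ n-1` (stated here with 0-indexed rows and columns). -/
def tauM (p n k : ℕ) (s : ZMod p) (r : Fin n → ZMod p) :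
    Matrix (Fin (n + 1)) (Fin (n + 1)) (ZMod p) :=
  Matrix.of fun i j =>
    if i.val = j.val then 1
    else if j.val = n then (if h : i.val < n then r ⟨i.val, h⟩ else 0)
    else if i.val = n - 1 then
      dvec p k s j.val * (if h : j.val < n then r ⟨j.val, h⟩ else 0)
    else 0

/-- `T(n,k,s) = { τ(r) : r ∈ Fp^n }`. -/
def Tset (p n k : ℕ) (s : ZMod p) :
    Set (Matrix (Fin (n + 1)) (Fin (n + 1)) (ZMod p)) :=
  { M | ∃ r : Fin n → ZMod p, M = tauM p n k s r }

/-- The block matrix `Q = [[P, 0], [0, 1]]` in `M_{n+1}(Fp)`. -/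
def QofP (p n : ℕ) (P : Matrix (Fin n) (Fin n) (ZMod p)) :
    Matrix (Fin (n + 1)) (Fin (n + 1)) (ZMod p) :=
  Matrix.reindex finSumFinEquiv finSumFinEquiv
    (Matrix.fromBlocks P 0 0 (1 : Matrix (Fin 1) (Fin 1) (ZMod p)))

lemma submatrix_equiv_inj {α β R : Type*} (e : α ≃ β) {A B : Matrix β β R} :
    A.submatrix e e = B.submatrix e e ↔ A = B :=
  (Matrix.reindex e.symm e.symm).injective.eq_iff

/-- The diagonal of the form: `k` ones followed by zeros. -/
def formDiag (p k m : ℕ) (i : Fin (k + m + 1)) : ZMod p := if i.val < k then 1 else 0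

/-- `P ↦ Q_P` as a monoid homomorphism on matrices. -/
def QofPHom (p n : ℕ) :
    Matrix (Fin n) (Fin n) (ZMod p) →* Matrix (Fin (n + 1)) (Fin (n + 1)) (ZMod p) where
  toFun := QofP p n
  map_one' := by simp [QofP]
  map_mul' A B := by
    simp only [QofP, reindex_apply, submatrix_mul_equiv, fromBlocks_multiply]
    simp

/-- `P ↦ Q_P`, with `GL_{n+1}` viewed as acting by conjugation. -/
def conjHom (p n : ℕ) : GL (Fin n) (ZMod p) →* ConjAct (GL (Fin (n + 1)) (ZMod p)) :=
  (ConjAct.toConjAct : GL (Fin (n + 1)) (ZMod p) ≃* _).toMonoidHom.comp (Units.map (QofPHom p n))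

lemma conjHom_smul (p n : ℕ) (P : GL (Fin n) (ZMod p))
    (M : Matrix (Fin (n + 1)) (Fin (n + 1)) (ZMod p)) :
    conjHom p n P • M = QofP p n P * M * (QofP p n P)⁻¹ := by
  change QofP p n P * M * ((Units.map (QofPHom p n) P)⁻¹ : GL (Fin (n + 1)) (ZMod p)).val = _
  rw [Matrix.coe_units_inv]
  rfl

lemma tauM_eq_fromBlocks (p k m : ℕ) (r : Fin (k + m + 1) → ZMod p) :
    tauM p (k + m + 1) k 1 r = Matrix.reindex finSumFinEquiv finSumFinEquiv
      (fromBlocks (1 + vecMulVec (Pi.single (Fin.last (k + m)) 1) (formDiag p k m * r))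
        (replicateCol (Fin 1) r) 0 1) := by
  have hd : ∀ j, dvec p k 1 j = if j < k then 1 else 0 := by
    intro j
    unfold dvec
    split_ifs <;> first | rfl | omega
  apply (Matrix.reindex finSumFinEquiv finSumFinEquiv).symm.injective
  rw [Equiv.symm_apply_apply]
  ext i j
  rcases i with i | i <;> rcases j with j | j
  · have hj : j.val ≠ k + m + 1 := by omega
    simp only [tauM, hd, reindex_symm, reindex_apply, submatrix_apply, Equiv.symm_symm, of_apply,
      finSumFinEquiv_apply_left, Fin.val_castAdd, fromBlocks_apply₁₁, Matrix.add_apply, Matrix.one_apply,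
      vecMulVec_apply, Pi.mul_apply, Pi.single_apply, formDiag, Fin.ext_iff, Fin.val_last, hj]
    by_cases h : i.val = j.val
    · by_cases h2 : i.val = k + m
      · have : ¬ (j.val < k) := by omega
        simp [h, this]
      · have : ¬ (j.val = k + m) := by omega
        simp [h, this]
    · have hj' : j.val ≤ k + m := by omega
      simp only [h, if_false]
      split_ifs <;> simp_all
  · have hi : i.val ≠ k + m + 1 := by omega
    have hi' : i.val ≤ k + m := by omega
    simp [tauM, hi, hi']
  · have hj : k + m + 1 ≠ j.val := by omega
    simp [tauM, hj, hj.symm]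
  · have : i = j := Subsingleton.elim _ _
    subst this
    simp [tauM]

/-- Equation saying that `Q_P` conjugates `τ(r)` to `τ(r')`. -/
lemma QofP_mul_tauM_iff (p k m : ℕ) (P : Matrix (Fin (k + m + 1)) (Fin (k + m + 1)) (ZMod p))
    (r r' : Fin (k + m + 1) → ZMod p) :
    QofP p _ P * tauM p _ k 1 r = tauM p _ k 1 r' * QofP p _ P ↔
      r' = P *ᵥ r ∧ ∀ i j, P i (Fin.last _) * (formDiag p k m j * r j) =
        if i = Fin.last _ then ((formDiag p k m * r') ᵥ* P) j else 0 := by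
  rw [tauM_eq_fromBlocks, tauM_eq_fromBlocks, QofP]
  simp only [reindex_apply, submatrix_mul_equiv, fromBlocks_multiply]
  rw [submatrix_equiv_inj, fromBlocks_inj]
  simp only [Matrix.mul_add, Matrix.add_mul, Matrix.mul_one, Matrix.one_mul, Matrix.mul_zero,
    Matrix.zero_mul, add_zero, zero_add,
    add_right_inj, and_true]
  rw [and_comm]
  refine and_congr ?_ ?_
  · rw [← replicateCol_mulVec, replicateCol_inj]
    exact eq_comm
  · rw [mul_vecMulVec, vecMulVec_mul, ← Matrix.ext_iff]
    refine forall_congr' fun i => forall_congr' fun j => ?_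
    simp [vecMulVec_apply, Pi.single_apply]

/-- The condition on `P` that characterizes the stabilizer of `T`. -/
def StabCond (p k m : ℕ) (P : Matrix (Fin (k + m + 1)) (Fin (k + m + 1)) (ZMod p)) : Prop :=
  (∀ i, i ≠ Fin.last _ → P i (Fin.last _) = 0) ∧
    Pᵀ * diagonal (formDiag p k m) * P =
      P (Fin.last _) (Fin.last _) • diagonal (formDiag p k m)

lemma stabCond_iff (p k m : ℕ) (hk : 1 ≤ k)
    (P : Matrix (Fin (k + m + 1)) (Fin (k + m + 1)) (ZMod p)) :
    StabCond p k m P ↔ ∀ r,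
      QofP p _ P * tauM p _ k 1 r = tauM p _ k 1 (P *ᵥ r) * QofP p _ P := by
  have hvec : ∀ r, (formDiag p k m * (P *ᵥ r)) ᵥ* P =
      (Pᵀ * diagonal (formDiag p k m) * P) *ᵥ r := by
    intro r
    have hT : (Pᵀ * diagonal (formDiag p k m) * P)ᵀ = Pᵀ * diagonal (formDiag p k m) * P := by
      simp [Matrix.mul_assoc]
    rw [← mulVec_transpose, ← mulVec_mulVec, ← mulVec_mulVec]
    congr 1
    ext i
    simp [mulVec_diagonal]
  simp only [QofP_mul_tauM_iff, hvec, true_and]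
  constructor
  · rintro ⟨h0, h1⟩ r i j
    split_ifs with hi
    · subst hi
      rw [h1, smul_mulVec, Pi.smul_apply, mulVec_diagonal, smul_eq_mul]
    · rw [h0 i hi, zero_mul]
  · intro h
    constructor
    · intro i hi
      have := h (Pi.single 0 1) i 0
      have h0 : formDiag p k m 0 = 1 := if_pos (by simpa using Nat.pos_of_ne_zero (by omega))
      simpa [hi, h0] using this
    · ext i j
      have := h (Pi.single j 1) (Fin.last _) i
      simp only [if_true, mulVec_single_one, col_apply] at this
      rw [← this]
      simp only [Matrix.smul_apply, diagonal_apply, Pi.single_apply, smul_eq_mul]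
      split_ifs <;> simp

lemma conj_Tset_iff (p k m : ℕ) [Fact p.Prime] (hk : 1 ≤ k) (P : GL (Fin (k + m + 1)) (ZMod p)) :
    (fun M => conjHom p _ P • M) '' Tset p (k + m + 1) k 1 = Tset p (k + m + 1) k 1 ↔
      StabCond p k m P := by
  have hQ : IsUnit (QofP p _ P.val).det :=
    (isUnit_iff_isUnit_det (QofP p _ P.val)).1 (Units.map (QofPHom p _) P).isUnit
  have key : ∀ M N, conjHom p _ P • M = N ↔ QofP p _ P.val * M = N * QofP p _ P.val := by
    intro M N
    rw [conjHom_smul]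
    constructor
    · rintro rfl
      rw [Matrix.mul_assoc, nonsing_inv_mul _ hQ, Matrix.mul_one]
    · intro h
      rw [h, Matrix.mul_assoc, mul_nonsing_inv _ hQ, Matrix.mul_one]
  rw [stabCond_iff p k m hk]
  constructor
  · intro h r
    have : conjHom p _ P • tauM p _ k 1 r ∈ Tset p (k + m + 1) k 1 := by
      rw [← h]; exact ⟨_, ⟨r, rfl⟩, rfl⟩
    obtain ⟨r', hr'⟩ := this
    rw [key] at hr'
    rwa [((QofP_mul_tauM_iff _ _ _ _ _ _).1 hr').1] at hr'
  · intro h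
    ext M
    constructor
    · rintro ⟨_, ⟨r, rfl⟩, rfl⟩
      exact ⟨_, (key _ _).2 (h r)⟩
    · rintro ⟨r, rfl⟩
      refine ⟨_, ⟨(P⁻¹).val *ᵥ r, rfl⟩, (key _ _).2 ?_⟩
      rw [h, mulVec_mulVec, Units.mul_inv, one_mulVec]

lemma card_range_mul_card_stabCond (p k m : ℕ) [Fact p.Prime] (hk : 1 ≤ k) :
    Nat.card (Set.range fun P : GL (Fin (k + m + 1)) (ZMod p) =>
        (fun M => QofP p _ (P : Matrix _ _ (ZMod p)) * M *
            (QofP p _ (P : Matrix _ _ (ZMod p)))⁻¹) '' Tset p (k + m + 1) k 1) *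
      Nat.card {P : GL (Fin (k + m + 1)) (ZMod p) // StabCond p k m P} =
    Nat.card (GL (Fin (k + m + 1)) (ZMod p)) := by
  let : MulAction (ConjAct (GL (Fin (k + m + 1 + 1)) (ZMod p)))
    (Set (Matrix (Fin (k + m + 1 + 1)) (Fin (k + m + 1 + 1)) (ZMod p))) := Set.mulActionSet
  let := MulAction.compHom
    (Set (Matrix (Fin (k + m + 1 + 1)) (Fin (k + m + 1 + 1)) (ZMod p))) (conjHom p (k + m + 1))
  have h := Nat.card_congr (MulAction.orbitProdStabilizerEquivGroup
    (GL (Fin (k + m + 1)) (ZMod p)) (Tset p (k + m + 1) k 1))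
  rw [Nat.card_prod] at h
  rw [← h]
  congr 1
  · congr 2
    simp only [MulAction.orbit, ← conjHom_smul]
    rfl
  · exact Nat.card_congr (Equiv.subtypeEquivRight fun P => (conj_Tset_iff p k m hk P).symm)

/-- Scaled orthogonal matrices: every multiplier is equally frequent in even dimension. -/
lemma card_similitudes (p k : ℕ) [Fact p.Prime] (hk : Even k) (c : (ZMod p)ˣ) :
    Nat.card {A : Matrix (Fin k) (Fin k) (ZMod p) // Aᵀ * A = (c : ZMod p) • 1} =
      Nat.card {U : Matrix (Fin k) (Fin k) (ZMod p) // Uᵀ * U = 1} := by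
  obtain ⟨j, rfl⟩ := hk
  obtain ⟨a, b, hab⟩ := ZMod.sq_add_sq p (c : ZMod p)
  obtain ⟨A, hA⟩ : ∃ A : Matrix (Fin (j + j)) (Fin (j + j)) (ZMod p),
      Aᵀ * A = (c : ZMod p) • 1 := by
    refine ⟨Matrix.reindex finSumFinEquiv finSumFinEquiv
      (fromBlocks (a • 1) (b • 1) (-b • 1) (a • 1)), ?_⟩
    rw [transpose_reindex, fromBlocks_transpose]
    simp only [reindex_apply, submatrix_mul_equiv, fromBlocks_multiply]
    have : (c : ZMod p) • (1 : Matrix (Fin (j + j)) (Fin (j + j)) (ZMod p)) =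
        ((c : ZMod p) • (1 : Matrix (Fin j ⊕ Fin j) (Fin j ⊕ Fin j) (ZMod p))).submatrix
          finSumFinEquiv.symm finSumFinEquiv.symm := by
      rw [submatrix_smul, Pi.smul_apply, Pi.smul_apply, submatrix_one_equiv]
    rw [this, ← fromBlocks_one, fromBlocks_smul, ← hab]
    congr 2
    · simp [smul_smul, ← add_smul]; congr 1; ring
    · simp [smul_smul, mul_comm]
    · simp [smul_smul, mul_comm]
    · simp [smul_smul, ← add_smul]; congr 1; ring
  have hu : IsUnit A := by
    refine IsUnit.of_mul_eq_one_right (((c⁻¹ : (ZMod p)ˣ) : ZMod p) • Aᵀ) ?_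
    rw [smul_mul_assoc, hA, smul_smul, Units.inv_mul, one_smul]
  obtain ⟨u, rfl⟩ := hu
  symm
  refine Nat.card_congr ((Units.mulLeft u).subtypeEquiv fun U => ?_)
  simp only [Units.mulLeft_apply, transpose_mul]
  rw [show Uᵀ * u.valᵀ * (u.val * U) = Uᵀ * (u.valᵀ * u.val) * U by simp only [Matrix.mul_assoc],
    hA, Matrix.mul_smul, Matrix.mul_one, Matrix.smul_mul]
  constructor
  · intro h; rw [h]
  · intro h
    exact (smul_right_injective _ c.ne_zero) h

/-- Block form of the stabilizer. -/
def stabBlocks (p k m : ℕ)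
    (x : ((Σ c : (ZMod p)ˣ, {A : Matrix (Fin k) (Fin k) (ZMod p) // Aᵀ * A = (c : ZMod p) • 1}) ×
      GL (Fin m) (ZMod p)) × Matrix (Fin m) (Fin k) (ZMod p) × (Fin k ⊕ Fin m → ZMod p)) :
    Matrix ((Fin k ⊕ Fin m) ⊕ Fin 1) ((Fin k ⊕ Fin m) ⊕ Fin 1) (ZMod p) :=
  fromBlocks (fromBlocks x.1.1.2.1 0 x.2.1 x.1.2) 0 (replicateRow (Fin 1) x.2.2)
    ((x.1.1.1 : ZMod p) • 1)

lemma stabBlocks_injective (p k m : ℕ) : Function.Injective (stabBlocks p k m) := by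
  rintro ⟨⟨⟨c, A, hA⟩, E⟩, C, w⟩ ⟨⟨⟨c', A', hA'⟩, E'⟩, C', w'⟩ h
  simp only [stabBlocks, fromBlocks_inj] at h
  obtain ⟨⟨rfl, -, rfl, hE⟩, -, hw, hc⟩ := h
  have hc' : c = c' := by
    have := congrFun (congrFun hc 0) 0
    simpa [Units.ext_iff] using this
  subst hc'
  rw [replicateRow_inj] at hw
  rw [Units.ext hE, hw]

lemma isUnit_and_form_iff (p k m : ℕ) [Fact p.Prime]
    (X : Matrix ((Fin k ⊕ Fin m) ⊕ Fin 1) ((Fin k ⊕ Fin m) ⊕ Fin 1) (ZMod p)) :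
    (IsUnit X ∧ (∀ i, X (Sum.inl i) (Sum.inr 0) = 0) ∧
      Xᵀ * fromBlocks (fromBlocks 1 0 0 0) 0 0 0 * X =
        X (Sum.inr 0) (Sum.inr 0) • fromBlocks (fromBlocks 1 0 0 0) 0 0 0) ↔
    X ∈ Set.range (stabBlocks p k m) := by
  constructor
  · obtain ⟨Y, u, w, c, rfl⟩ : ∃ Y u w c, X = fromBlocks Y u w c :=
      ⟨_, _, _, _, (fromBlocks_toBlocks X).symm⟩
    obtain ⟨A, B, C, E, rfl⟩ : ∃ A B C E, Y = fromBlocks A B C E :=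
      ⟨_, _, _, _, (fromBlocks_toBlocks Y).symm⟩
    rintro ⟨hX, hu, hf⟩
    obtain rfl : u = 0 := by
      ext i j
      rw [Subsingleton.elim j 0]
      exact hu i
    rw [isUnit_iff_isUnit_det, det_fromBlocks_zero₁₂, IsUnit.mul_iff] at hX
    obtain ⟨hY, hc⟩ := hX
    have hc1 : c = c 0 0 • 1 := by
      ext i j
      rw [Subsingleton.elim i 0, Subsingleton.elim j 0]
      simp
    rw [det_fin_one] at hc
    simp only [fromBlocks_transpose, fromBlocks_multiply, fromBlocks_smul, fromBlocks_inj,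
      fromBlocks_apply₂₂, smul_zero, Matrix.mul_zero, Matrix.mul_one, Matrix.zero_mul, add_zero] at hf
    obtain ⟨⟨hA, hAB, -, -⟩, -⟩ := hf
    have hB : B = 0 := by
      have hAu : IsUnit Aᵀ := by
        refine IsUnit.of_mul_eq_one (((hc.unit⁻¹ : (ZMod p)ˣ) : ZMod p) • A) ?_
        rw [Matrix.mul_smul, hA, smul_smul, IsUnit.val_inv_mul, one_smul]
      obtain ⟨v, hv⟩ := hAu
      have : (v⁻¹).val * (v.val * B) = 0 := by rw [hv, hAB, Matrix.mul_zero]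
      rwa [← Matrix.mul_assoc, Units.inv_mul, Matrix.one_mul] at this
    subst hB
    rw [det_fromBlocks_zero₁₂, IsUnit.mul_iff] at hY
    have hE := (isUnit_iff_isUnit_det _).2 hY.2
    refine ⟨((⟨hc.unit, A, by simpa using hA⟩, hE.unit), C, w 0), ?_⟩
    simp only [stabBlocks, IsUnit.unit_spec, ← hc1]
    congr 1
    ext i j
    rw [Subsingleton.elim i 0]
    rfl
  · rintro ⟨⟨⟨⟨c, A, hA⟩, E⟩, C, w⟩, rfl⟩
    simp only [stabBlocks]
    refine ⟨?_, ?_, ?_⟩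
    · have hAu : IsUnit A := by
        refine IsUnit.of_mul_eq_one_right (((c⁻¹ : (ZMod p)ˣ) : ZMod p) • Aᵀ) ?_
        rw [smul_mul_assoc, hA, smul_smul, Units.inv_mul, one_smul]
      rw [isUnit_iff_isUnit_det, det_fromBlocks_zero₁₂, det_fromBlocks_zero₁₂, IsUnit.mul_iff,
        IsUnit.mul_iff, ← isUnit_iff_isUnit_det, ← isUnit_iff_isUnit_det]
      exact ⟨⟨hAu, E.isUnit⟩, by simp⟩
    · simp
    · simp [fromBlocks_transpose, fromBlocks_multiply, fromBlocks_smul, hA]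

/-- The coordinates `1..k`, `k+1..k+m`, `k+m+1` as a sum type. -/
def coordEquiv (k m : ℕ) : (Fin k ⊕ Fin m) ⊕ Fin 1 ≃ Fin (k + m + 1) :=
  (Equiv.sumCongr finSumFinEquiv (Equiv.refl _)).trans finSumFinEquiv

lemma stabCond_reindex_iff (p k m : ℕ)
    (X : Matrix ((Fin k ⊕ Fin m) ⊕ Fin 1) ((Fin k ⊕ Fin m) ⊕ Fin 1) (ZMod p)) :
    StabCond p k m (Matrix.reindex (coordEquiv k m) (coordEquiv k m) X) ↔
      (∀ i, X (Sum.inl i) (Sum.inr 0) = 0) ∧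
      Xᵀ * fromBlocks (fromBlocks 1 0 0 0) 0 0 0 * X =
        X (Sum.inr 0) (Sum.inr 0) • fromBlocks (fromBlocks 1 0 0 0) 0 0 0 := by
  have hlast : Fin.last (k + m) = coordEquiv k m (Sum.inr 0) := by
    ext; simp [coordEquiv]
  have hD : diagonal (formDiag p k m) = Matrix.reindex (coordEquiv k m) (coordEquiv k m)
      (fromBlocks (fromBlocks 1 0 0 0) 0 0 0) := by
    apply (Matrix.reindex (coordEquiv k m) (coordEquiv k m)).symm.injective
    rw [Equiv.symm_apply_apply, reindex_symm, reindex_apply, submatrix_diagonal_equiv]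
    rw [← diagonal_one, ← diagonal_zero, fromBlocks_diagonal, ← diagonal_zero,
      fromBlocks_diagonal]
    congr 1
    ext ((i | i) | i) <;> simp [formDiag, coordEquiv]
  unfold StabCond
  rw [hlast, hD]
  refine and_congr ?_ ?_
  · rw [← (coordEquiv k m).forall_congr_right]
    simp
  · rw [transpose_reindex]
    simp only [reindex_apply, submatrix_mul_equiv, submatrix_apply, Equiv.symm_apply_apply]
    exact submatrix_equiv_inj (coordEquiv k m).symm (B := X (Sum.inr 0) (Sum.inr 0) • _)

lemma card_stabCond (p k m : ℕ) [Fact p.Prime] (hk : Even k) :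
    Nat.card {P : GL (Fin (k + m + 1)) (ZMod p) // StabCond p k m P} =
      (p - 1) * Nat.card {U : Matrix (Fin k) (Fin k) (ZMod p) // Uᵀ * U = 1} *
        Nat.card (GL (Fin m) (ZMod p)) * p ^ (k * m + (k + m)) := by
  have hR : Nat.card (Set.range (stabBlocks p k m)) =
      (p - 1) * Nat.card {U : Matrix (Fin k) (Fin k) (ZMod p) // Uᵀ * U = 1} *
        Nat.card (GL (Fin m) (ZMod p)) * p ^ (k * m + (k + m)) := by
    rw [Nat.card_range_of_injective (stabBlocks_injective p k m), Nat.card_prod, Nat.card_prod,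
      Nat.card_prod, Nat.card_sigma]
    simp only [card_similitudes p k hk]
    have hM : Nat.card (Matrix (Fin m) (Fin k) (ZMod p)) = p ^ (k * m) := by
      rw [Matrix, Nat.card_fun, Nat.card_fun]
      simp [pow_mul]
    rw [hM, Nat.card_fun]
    simp [ZMod.card_units_eq_totient, Nat.totient_prime Fact.out, pow_add]
  rw [← hR]
  have hiff : ∀ X, X ∈ Set.range (stabBlocks p k m) ↔ IsUnit X ∧
      StabCond p k m (Matrix.reindex (coordEquiv k m) (coordEquiv k m) X) := fun X => by
    rw [stabCond_reindex_iff, isUnit_and_form_iff]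
  refine Nat.card_congr (Equiv.ofBijective (fun P => ⟨(Matrix.reindex (coordEquiv k m)
    (coordEquiv k m)).symm P.1.val, (hiff _).2 ⟨?_, ?_⟩⟩) ⟨?_, ?_⟩)
  · rw [reindex_symm, reindex_apply, isUnit_submatrix_equiv]
    exact P.1.isUnit
  · rw [Equiv.apply_symm_apply]
    exact P.2
  · intro P P' h
    exact Subtype.ext (Units.ext ((Matrix.reindex _ _).symm.injective (Subtype.ext_iff.1 h)))
  · rintro ⟨X, hX⟩
    obtain ⟨hu, hs⟩ := (hiff X).1 hX
    have hu' : IsUnit (Matrix.reindex (coordEquiv k m) (coordEquiv k m) X) := by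
      rwa [reindex_apply, isUnit_submatrix_equiv]
    exact ⟨⟨hu'.unit, hs⟩, Subtype.ext (Equiv.symm_apply_apply _ _)⟩

/-- For `k` even and `s = 1`, the number of distinct conjugates of
`T(n,k,1)` under `Q_P` for `P ∈ GL_n(Fp)` equals `|GL_n|` divided by
`(p-1)·|O_k|·|GL_{n-1-k}|·p^{k(n-1-k)+(n-1)}`. -/
theorem stmt_9 (p : ℕ) (hp : p.Prime) (hodd : Odd p) (n k : ℕ)
    (hn : 2 ≤ n) (hk1 : 1 ≤ k) (hk2 : k ≤ n - 1) (hkeven : Even k) :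
    Nat.card (Set.range fun P : GL (Fin n) (ZMod p) =>
        (fun M => QofP p n (P : Matrix (Fin n) (Fin n) (ZMod p)) * M *
            (QofP p n (P : Matrix (Fin n) (Fin n) (ZMod p)))⁻¹) ''
          Tset p n k 1) =
      Nat.card (GL (Fin n) (ZMod p)) /
        ((p - 1) *
          Nat.card {U : Matrix (Fin k) (Fin k) (ZMod p) // Uᵀ * U = 1} *
          Nat.card (GL (Fin (n - 1 - k)) (ZMod p)) *
          p ^ (k * (n - 1 - k) + (n - 1))) := by
  have := Fact.mk hp
  obtain ⟨m, rfl⟩ : ∃ m, n = k + m + 1 := ⟨n - 1 - k, by omega⟩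
  have hm : k + m + 1 - 1 - k = m := by omega
  have hpos : 0 < Nat.card {P : GL (Fin (k + m + 1)) (ZMod p) // StabCond p k m P} := by
    by_contra h0
    have := card_range_mul_card_stabCond p k m hk1
    rw [Nat.eq_zero_of_not_pos h0, mul_zero] at this
    exact Nat.card_pos.ne this
  rw [hm, Nat.add_sub_cancel, ← card_stabCond p k m hkeven,
    ← card_range_mul_card_stabCond p k m hk1, Nat.mul_div_cancel _ hpos]
end

section
/- Let p be an odd prime and Fp = ZMod p. Let T ⊆ GL_5(Fp) be the set of matrices [[1,0,0,0,r₁],[0,1,0,0,r₂],[0,0,1,0,r₃],[r₁,0,0,1,r₄],[0,0,0,0,1]] for r₁, r₂, r₃, r₄ ∈ Fp. Then the number of distinct sets of the form { Q_P·M·Q_P⁻¹ : M ∈ T }, as P ranges over GL_4(Fp) and Q_P = [[P,0],[0,1]] ∈ GL_5(Fp), equals (p² + 1)(p + 1)(p³ − 1). -/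
open Matrix

/-- A nonzero covector `φ` together with a nonzero vector `w` in its kernel. -/
abbrev IncidentPair (K : Type*) [Field K] (n : ℕ) :=
  Σ φ : {φ : Fin n → K // φ ≠ 0}, {w : Fin n → K // w ≠ 0 ∧ φ.1 ⬝ᵥ w = 0}

namespace IncidentPair

variable {K : Type*} [Field K] {n : ℕ}

/-- The linear functional `v ↦ φ ⬝ᵥ v`. -/
def dotFunctional (φ : Fin n → K) : (Fin n → K) →ₗ[K] K := dotProductBilin K K φ

theorem dotFunctional_apply (φ v : Fin n → K) : dotFunctional φ v = φ ⬝ᵥ v := rfl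

theorem dotFunctional_ne_zero {φ : Fin n → K} (hφ : φ ≠ 0) : dotFunctional φ ≠ 0 := by
  intro h
  refine hφ (funext fun i => ?_)
  simpa [dotFunctional_apply] using LinearMap.congr_fun h (Pi.single i 1)

theorem finrank_ker_dotFunctional {φ : Fin (n + 1) → K} (hφ : φ ≠ 0) :
    Module.finrank K (LinearMap.ker (dotFunctional φ)) = n := by
  have h := Module.Dual.finrank_ker_add_one_of_ne_zero (dotFunctional_ne_zero hφ)
  simpa using h

theorem natCard_ne_zero {V : Type*} [AddCommGroup V] [Module K V] [Finite K]
    [Module.Finite K V] :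
    Nat.card {v : V // v ≠ 0} = Nat.card K ^ Module.finrank K V - 1 := by
  classical
  have : Finite V := Module.finite_of_finite K
  have := Fintype.ofFinite V
  rw [← Module.natCard_eq_pow_finrank, Nat.card_eq_fintype_card, Nat.card_eq_fintype_card]
  simp [Fintype.card_subtype_compl]

theorem natCard [Finite K] :
    Nat.card (IncidentPair K (n + 1)) =
      (Nat.card K ^ (n + 1) - 1) * (Nat.card K ^ n - 1) := by
  have key (φ : {φ : Fin (n + 1) → K // φ ≠ 0}) :
      Nat.card {w : Fin (n + 1) → K // w ≠ 0 ∧ φ.1 ⬝ᵥ w = 0} = Nat.card K ^ n - 1 := by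
    have h := natCard_ne_zero (K := K) (V := LinearMap.ker (dotFunctional φ.1))
    rw [finrank_ker_dotFunctional φ.2] at h
    rw [← h]
    exact Nat.card_congr
      { toFun := fun w => ⟨⟨w.1, w.2.2⟩, fun h => w.2.1 (congrArg Subtype.val h)⟩
        invFun := fun w => ⟨w.1.1, fun h => w.2 (Subtype.ext h), w.1.2⟩
        left_inv := fun _ => rfl
        right_inv := fun _ => rfl }
  have := Fintype.ofFinite {φ : Fin (n + 1) → K // φ ≠ 0}
  rw [Nat.card_sigma, Finset.sum_congr rfl fun φ _ => key φ, Finset.sum_const,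
    Finset.card_univ, ← Nat.card_eq_fintype_card,
    natCard_ne_zero (K := K)]
  simp

/-- The action `c • (φ, w) = (c φ, c⁻² w)` of the units. -/
def scale (c : Kˣ) (x : IncidentPair K n) : IncidentPair K n :=
  ⟨⟨(c : K) • x.1.1, smul_ne_zero c.ne_zero x.1.2⟩,
    ⟨((c : K) ^ 2)⁻¹ • x.2.1,
      smul_ne_zero (inv_ne_zero (pow_ne_zero _ c.ne_zero)) x.2.2.1, by
        simp [x.2.2.2]⟩⟩

theorem ext_val {x y : IncidentPair K n} (h₁ : x.1.1 = y.1.1) (h₂ : x.2.1 = y.2.1) : x = y := by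
  obtain ⟨⟨φ, hφ⟩, ⟨w, hw⟩⟩ := x
  obtain ⟨⟨φ', hφ'⟩, ⟨w', hw'⟩⟩ := y
  obtain rfl : φ = φ' := h₁
  obtain rfl : w = w' := h₂
  rfl

theorem scale_left_injective (x : IncidentPair K n) :
    Function.Injective fun c : Kˣ => scale c x := by
  intro c d h
  obtain ⟨i, hi⟩ := Function.ne_iff.1 x.1.2
  have h' : (c : K) * x.1.1 i = d * x.1.1 i :=
    congrArg (fun y : IncidentPair K n => y.1.1 i) h
  exact Units.ext (mul_right_cancel₀ hi h')

/-- The linear map `v ↦ φ(v) (w ⊗ φ)`, as a function with values in matrices. -/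
def tensor (x : IncidentPair K n) (v : Fin n → K) : Matrix (Fin n) (Fin n) K :=
  (x.1.1 ⬝ᵥ v) • vecMulVec x.2.1 x.1.1

theorem tensor_scale (c : Kˣ) (x : IncidentPair K n) : tensor (scale c x) = tensor x := by
  funext v
  have hc := c.ne_zero
  ext i j
  simp only [tensor, scale, smul_dotProduct, Matrix.smul_apply, vecMulVec_apply, Pi.smul_apply,
    smul_eq_mul]
  field_simp

theorem exists_scale_eq {x y : IncidentPair K n} (h : tensor x = tensor y) :
    ∃ c, scale c x = y := by
  have key (i j k : Fin n) :
      x.1.1 i * (x.2.1 j * x.1.1 k) = y.1.1 i * (y.2.1 j * y.1.1 k) := by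
    have := congrFun (congrFun (congrFun h (Pi.single i 1)) j) k
    simpa [tensor, vecMulVec_apply] using this
  obtain ⟨i, hi⟩ := Function.ne_iff.1 x.1.2
  obtain ⟨j, hj⟩ := Function.ne_iff.1 x.2.2.1
  simp only [Pi.zero_apply] at hi hj
  have hne : y.1.1 i * (y.2.1 j * y.1.1 i) ≠ 0 := by
    rw [← key]; exact mul_ne_zero hi (mul_ne_zero hj hi)
  have hi' : y.1.1 i ≠ 0 := left_ne_zero_of_mul hne
  have hj' : y.2.1 j ≠ 0 := left_ne_zero_of_mul (right_ne_zero_of_mul hne)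
  set c : K := (x.1.1 i * x.2.1 j) / (y.1.1 i * y.2.1 j)
  have hc : c ≠ 0 := div_ne_zero (mul_ne_zero hi hj) (mul_ne_zero hi' hj')
  have hφ (k : Fin n) : c * x.1.1 k = y.1.1 k := by
    rw [div_mul_eq_mul_div, div_eq_iff (mul_ne_zero hi' hj')]
    linear_combination key i j k
  refine ⟨Units.mk0 c hc, ext_val (funext hφ) (funext fun k => ?_)⟩
  simp only [scale, Units.val_mk0, Pi.smul_apply, smul_eq_mul]
  rw [inv_mul_eq_iff_eq_mul₀ (pow_ne_zero 2 hc)]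
  have h₁ := key i k i
  rw [← hφ i] at h₁
  refine mul_left_cancel₀ (mul_ne_zero hi hi) ?_
  linear_combination h₁

theorem natCard_eq_mul_natCard_range {α : Type*} (f : IncidentPair K n → α)
    (hf : ∀ x y, f x = f y ↔ tensor x = tensor y) :
    Nat.card (IncidentPair K n) = Nat.card (Set.range f) * Nat.card Kˣ := by
  rw [← Nat.card_prod]
  have hscale (c : Kˣ) (x : IncidentPair K n) : f (scale c x) = f x :=
    (hf _ _).2 (tensor_scale c x)
  refine (Nat.card_congr (Equiv.ofBijective
    (fun s : Set.range f × Kˣ => scale s.2 s.1.2.choose) ⟨?_, fun y => ?_⟩)).symm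
  · rintro ⟨s, c⟩ ⟨t, d⟩ h
    obtain rfl : s = t := by
      have h' := congrArg f h
      simp only [hscale] at h'
      exact Subtype.ext (by rw [← s.2.choose_spec, h', t.2.choose_spec])
    exact congrArg _ (scale_left_injective _ h)
  · let s : Set.range f := ⟨f y, y, rfl⟩
    obtain ⟨c, hc⟩ := exists_scale_eq ((hf _ _).1 s.2.choose_spec)
    exact ⟨(s, c), hc⟩

/-- The pair of the first row of `P⁻¹` and the last column of `P`. -/
def ofGL (P : GL (Fin (n + 2)) K) : IncidentPair K (n + 2) :=
  ⟨⟨Pi.single 0 1 ᵥ* (P⁻¹ : GL (Fin (n + 2)) K).1, fun h => by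
      have := congrArg (· ᵥ* P.1) h
      simp [-single_vecMul, vecMul_vecMul, -coe_units_inv,
        ← Units.val_mul] at this⟩,
    ⟨P.1 *ᵥ Pi.single (Fin.last _) 1, fun h => by
        have := congrArg ((P⁻¹ : GL (Fin (n + 2)) K).1 *ᵥ ·) h
        simp [-mulVec_single, mulVec_mulVec, -coe_units_inv,
          ← Units.val_mul] at this,
      by
        rw [← dotProduct_mulVec, mulVec_mulVec, ← Units.val_mul, inv_mul_cancel, Units.val_one,
          one_mulVec]
        simp [Fin.ext_iff]⟩⟩

theorem tensor_ofGL_conj (P : GL (Fin (n + 2)) K) (r : Fin (n + 2) → K) :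
    P.1 * tensor (ofGL 1) r * (P⁻¹ : GL (Fin (n + 2)) K).1 = tensor (ofGL P) (P.1 *ᵥ r) := by
  have h : (ofGL P).1.1 ⬝ᵥ P.1 *ᵥ r = (ofGL (1 : GL (Fin (n + 2)) K)).1.1 ⬝ᵥ r := by
    simp only [ofGL]
    rw [dotProduct_mulVec, vecMul_vecMul, ← Units.val_mul, inv_mul_cancel, inv_one]
  rw [tensor, tensor, h, Matrix.mul_smul, Matrix.smul_mul, mul_vecMulVec, vecMulVec_mul]
  simp only [ofGL, inv_one, Units.val_one, one_mulVec, vecMul_one]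

theorem exists_basis_last_eq {V : Type*} [AddCommGroup V] [Module K V] [Module.Finite K V]
    (hV : Module.finrank K V = n + 1) {w : V} (hw : w ≠ 0) :
    ∃ b : Module.Basis (Fin (n + 1)) K V, b (Fin.last n) = w := by
  obtain ⟨g, hg⟩ := Module.Projective.exists_dual_eq_one K hw
  have hg0 : g ≠ 0 := fun h => by simp [h] at hg
  have hrank : Module.finrank K (LinearMap.ker g) = n := by
    have h := Module.Dual.finrank_ker_add_one_of_ne_zero hg0
    omega
  let b₀ := Module.finBasisOfFinrankEq K (LinearMap.ker g) hrank
  refine ⟨.mkFinSnoc b₀ w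
    (fun c z hz h => by simpa [LinearMap.mem_ker.1 hz, hg] using congrArg g h)
    (fun z => ⟨-g z, by simp [LinearMap.mem_ker, hg]⟩), by simp⟩

theorem ofGL_surjective : Function.Surjective (ofGL : GL (Fin (n + 2)) K → _) := by
  rintro ⟨⟨φ, hφ⟩, ⟨w, hw, hφw⟩⟩
  obtain ⟨u, hu⟩ : ∃ u, dotFunctional φ u = 1 :=
    LinearMap.surjective (dotFunctional_ne_zero hφ) 1
  obtain ⟨b₁, hb₁⟩ := exists_basis_last_eq (finrank_ker_dotFunctional hφ)
    (w := ⟨w, hφw⟩) fun h => hw (congrArg Subtype.val h)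
  let b : Module.Basis (Fin (n + 2)) K (Fin (n + 2) → K) := .mkFinCons u b₁
    (fun c z hz h => by
      simpa [LinearMap.mem_ker.1 hz, hu] using congrArg (dotFunctional φ) h)
    (fun z => ⟨-dotFunctional φ z, by simp [LinearMap.mem_ker, hu]⟩)
  have hlast : b (Fin.last _) = w := by
    simp [b, ← Fin.succ_last, hb₁]
  have hφb (j : Fin (n + 2)) : φ ⬝ᵥ b j = (Pi.single 0 1 : Fin (n + 2) → K) j := by
    refine Fin.cases ?_ (fun j => ?_) j
    · simpa [b, dotFunctional_apply] using hu
    · have h : φ ⬝ᵥ (b₁ j : Fin (n + 2) → K) = 0 := (b₁ j).2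
      simpa [b] using h
  let e := Pi.basisFun K (Fin (n + 2))
  let P : GL (Fin (n + 2)) K :=
    ⟨e.toMatrix b, b.toMatrix e, e.toMatrix_mul_toMatrix_flip b, b.toMatrix_mul_toMatrix_flip e⟩
  refine ⟨P, ext_val ?_ ?_⟩
  · have h : φ ᵥ* P.1 = Pi.single 0 1 := funext hφb
    change Pi.single 0 1 ᵥ* (P⁻¹ : GL (Fin (n + 2)) K).1 = φ
    rw [← h, vecMul_vecMul, ← Units.val_mul, mul_inv_cancel, Units.val_one, vecMul_one]
  · change P.1 *ᵥ Pi.single (Fin.last _) 1 = w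
    rw [mulVec_single_one, ← hlast]
    rfl

/-- The affine matrix `[[1 + φ(v) (w ⊗ φ), v], [0, 1]]`. -/
def affine (x : IncidentPair K n) (v : Fin n → K) : Matrix (Fin (n + 1)) (Fin (n + 1)) K :=
  reindex finSumFinEquiv finSumFinEquiv
    (fromBlocks (1 + tensor x v) (replicateCol (Fin 1) v) 0 1)

theorem range_affine_eq_iff (x y : IncidentPair K n) :
    Set.range (affine x) = Set.range (affine y) ↔ tensor x = tensor y := by
  constructor
  · intro h
    funext v
    obtain ⟨v', hv'⟩ : affine x v ∈ Set.range (affine y) := h ▸ Set.mem_range_self v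
    obtain ⟨h₁, h₂, -, -⟩ := fromBlocks_inj.1 ((reindex _ _).injective hv')
    obtain rfl : v' = v := replicateCol_injective h₂
    exact (add_left_cancel h₁).symm
  · intro h
    have : affine x = affine y := by funext v; simp [affine, h]
    rw [this]

end IncidentPair

theorem QofP_mul (p n : ℕ) (A B : Matrix (Fin n) (Fin n) (ZMod p)) :
    QofP p n A * QofP p n B = QofP p n (A * B) := by
  simp [QofP, fromBlocks_multiply, submatrix_mul_equiv]

theorem QofP_inv (p n : ℕ) (P : GL (Fin n) (ZMod p)) :
    (QofP p n P.1)⁻¹ = QofP p n (P⁻¹ : GL (Fin n) (ZMod p)).1 := by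
  refine inv_eq_right_inv ?_
  rw [QofP_mul, ← Units.val_mul, mul_inv_cancel]
  simp [QofP]

theorem QofP_conj_affine {p : ℕ} [Fact p.Prime] (P : GL (Fin 4) (ZMod p))
    (r : Fin 4 → ZMod p) :
    QofP p 4 P.1 * (IncidentPair.ofGL (n := 2) 1).affine r * (QofP p 4 P.1)⁻¹ =
      (IncidentPair.ofGL (n := 2) P).affine (P.1 *ᵥ r) := by
  have hPP : P.1 * (P⁻¹ : GL (Fin 4) (ZMod p)).1 = 1 := by
    rw [← Units.val_mul, mul_inv_cancel, Units.val_one]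
  have hconj := IncidentPair.tensor_ofGL_conj (n := 2) P r
  rw [QofP_inv]
  simp only [QofP, IncidentPair.affine, reindex_apply, submatrix_mul_equiv, fromBlocks_multiply]
  simp only [Matrix.mul_zero, Matrix.zero_mul, add_zero, zero_add, Matrix.mul_one, ← replicateCol_mulVec,
    zero_mulVec, replicateCol_zero, mul_add, add_mul, hPP]
  rw [hconj]

theorem affine_ofGL_one {p : ℕ} [Fact p.Prime] (r : Fin 4 → ZMod p) :
    (IncidentPair.ofGL (n := 2) (1 : GL (Fin 4) (ZMod p))).affine r =
      !![1, 0, 0, 0, r 0; 0, 1, 0, 0, r 1; 0, 0, 1, 0, r 2;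
         r 0, 0, 0, 1, r 3; 0, 0, 0, 0, 1] := by
  ext i j
  refine Fin.addCases (m := 4) (n := 1) (fun i => ?_) (fun i => ?_) i <;>
    refine Fin.addCases (m := 4) (n := 1) (fun j => ?_) (fun j => ?_) j <;>
    simp only [IncidentPair.affine, reindex_apply, submatrix_apply,
      finSumFinEquiv_symm_apply_castAdd, finSumFinEquiv_symm_apply_natAdd] <;>
    fin_cases i <;> fin_cases j <;>
    simp [IncidentPair.tensor, IncidentPair.ofGL, vecMulVec_apply]

/-- `n = 4, k = 1, s = 1`: the number of distinct sets
`Q_P·T·Q_P⁻¹` for `P ∈ GL_4(Fp)` is `(p²+1)(p+1)(p³-1)`. -/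
theorem stmt_15 (p : ℕ) (hp : p.Prime) (hodd : Odd p) :
    Nat.card (Set.range fun P : GL (Fin 4) (ZMod p) =>
        (fun M => QofP p 4 (P : Matrix (Fin 4) (Fin 4) (ZMod p)) * M *
            (QofP p 4 (P : Matrix (Fin 4) (Fin 4) (ZMod p)))⁻¹) ''
          { M | ∃ r₁ r₂ r₃ r₄ : ZMod p,
              M = !![1, 0, 0, 0, r₁; 0, 1, 0, 0, r₂; 0, 0, 1, 0, r₃;
                     r₁, 0, 0, 1, r₄; 0, 0, 0, 0, 1] }) =
      (p ^ 2 + 1) * (p + 1) * (p ^ 3 - 1) := by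
  have : Fact p.Prime := ⟨hp⟩
  have hT : { M | ∃ r₁ r₂ r₃ r₄ : ZMod p,
      M = !![1, 0, 0, 0, r₁; 0, 1, 0, 0, r₂; 0, 0, 1, 0, r₃;
             r₁, 0, 0, 1, r₄; 0, 0, 0, 0, 1] } =
      Set.range (IncidentPair.ofGL (n := 2) (1 : GL (Fin 4) (ZMod p))).affine := by
    ext M
    constructor
    · rintro ⟨r₁, r₂, r₃, r₄, rfl⟩
      exact ⟨![r₁, r₂, r₃, r₄], affine_ofGL_one _⟩
    · rintro ⟨r, rfl⟩
      exact ⟨r 0, r 1, r 2, r 3, affine_ofGL_one r⟩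
  have hconj (P : GL (Fin 4) (ZMod p)) :
      (fun M => QofP p 4 P.1 * M * (QofP p 4 P.1)⁻¹) ''
        Set.range (IncidentPair.ofGL (n := 2) (1 : GL (Fin 4) (ZMod p))).affine =
      Set.range (IncidentPair.ofGL (n := 2) P).affine := by
    rw [← Set.range_comp]
    have hsurj : Function.Surjective (P.1 *ᵥ · : (Fin 4 → ZMod p) → _) := fun v =>
      ⟨(P⁻¹ : GL (Fin 4) (ZMod p)).1 *ᵥ v, by
        simp only [mulVec_mulVec, ← Units.val_mul, mul_inv_cancel, Units.val_one, one_mulVec]⟩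
    rw [← hsurj.range_comp (IncidentPair.affine _)]
    exact congrArg Set.range (funext fun r => QofP_conj_affine P r)
  simp only [hT, hconj]
  have hrange := (IncidentPair.ofGL_surjective (K := ZMod p) (n := 2)).range_comp
    fun x => Set.range x.affine
  have hcard := IncidentPair.natCard_eq_mul_natCard_range
    (fun x : IncidentPair (ZMod p) 4 => Set.range x.affine) IncidentPair.range_affine_eq_iff
  rw [IncidentPair.natCard, Nat.card_units, Nat.card_zmod, ← hrange] at hcard
  refine Nat.eq_of_mul_eq_mul_right (Nat.sub_pos_of_lt hp.one_lt) (hcard.symm.trans ?_)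
  have h4 : p ^ 4 - 1 = (p ^ 2 + 1) * (p + 1) * (p - 1) := by
    zify [hp.one_le, Nat.one_le_pow 4 p hp.pos]
    ring
  rw [h4]
  ring
end
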